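/- Let m ≥ 5. Let φ_1 and φ_2 be the ℂ-algebra automorphisms of R_m determined by φ_1: x_i ↦ x_i, y_i ↦ −y_i, z_i ↦ z_i, and φ_2: x_i ↦ x_i, y_i ↦ −(1/2)y_i + (3/2)z_i, z_i ↦ −(1/2)y_i − (1/2)z_i (for 0 ≤ i ≤ m). Then φ_1(I_m^0) = I_m^0, φ_1(I_m^1) = I_m^1, φ_1(I_m^2) = I_m^3, φ_1(I_m^3) = I_m^2, and φ_2(I_m^0) = I_m^0, φ_2(I_m^1) = I_m^3, φ_2(I_m^2) = I_m^1, φ_2(I_m^3) = I_m^2. -/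

import Mathlib

noncomputable section

open MvPolynomial

/-- `R m = ℂ[x_0,…,x_m, y_0,…,y_m, z_0,…,z_m]`. -/
abbrev R (m : ℕ) : Type := MvPolynomial (Fin 3 × Fin (m + 1)) ℂ

/-- the variable `x_i` (for `i ≤ m`). -/
def Xv (m i : ℕ) : R m := if h : i < m + 1 then X (0, ⟨i, h⟩) else 0
/-- the variable `y_i` (for `i ≤ m`). -/
def Yv (m i : ℕ) : R m := if h : i < m + 1 then X (1, ⟨i, h⟩) else 0
/-- the variable `z_i` (for `i ≤ m`). -/
def Zv (m i : ℕ) : R m := if h : i < m + 1 then X (2, ⟨i, h⟩) else 0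

/-- `Σ_{i=0}^m x_i t^i`. -/
def xSer (m : ℕ) : Polynomial (R m) :=
  ∑ i ∈ Finset.range (m + 1), Polynomial.C (Xv m i) * Polynomial.X ^ i
/-- `Σ_{i=0}^m y_i t^i`. -/
def ySer (m : ℕ) : Polynomial (R m) :=
  ∑ i ∈ Finset.range (m + 1), Polynomial.C (Yv m i) * Polynomial.X ^ i
/-- `Σ_{i=0}^m z_i t^i`. -/
def zSer (m : ℕ) : Polynomial (R m) :=
  ∑ i ∈ Finset.range (m + 1), Polynomial.C (Zv m i) * Polynomial.X ^ i

/-- `f^{(j)}`: the coefficient of `t^j` in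
`f(Σ x_i t^i, Σ y_i t^i, Σ z_i t^i)` for `f = x² − y²z + z³` (the `D₄` singularity). -/
def fD (m j : ℕ) : R m :=
  (xSer m ^ 2 - ySer m ^ 2 * zSer m + zSer m ^ 3).coeff j

/-- The ideal `⟨f^{(0)},…,f^{(m)}⟩`. -/
def FId (m : ℕ) : Ideal (R m) := Ideal.span {g | ∃ j ≤ m, g = fD m j}

/-- `I_m^0 = ⟨x_0, x_1, x_2, y_0, y_1, z_0, z_1, f^{(0)},…,f^{(m)}⟩`. -/
def I0 (m : ℕ) : Ideal (R m) :=
  Ideal.span {Xv m 0, Xv m 1, Xv m 2, Yv m 0, Yv m 1, Zv m 0, Zv m 1} ⊔ FId m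

/-- `J_m^1 = ⟨x_0, x_1, y_0, z_0, z_1, f^{(0)},…,f^{(m)}⟩`,
`J_m^2 = ⟨x_0, x_1, y_0, z_0, y_1 − z_1, f^{(0)},…,f^{(m)}⟩`,
`J_m^3 = ⟨x_0, x_1, y_0, z_0, y_1 + z_1, f^{(0)},…,f^{(m)}⟩`. -/
def Jd (m : ℕ) : ℕ → Ideal (R m)
  | 2 => Ideal.span {Xv m 0, Xv m 1, Yv m 0, Zv m 0, Yv m 1 - Zv m 1} ⊔ FId m
  | 3 => Ideal.span {Xv m 0, Xv m 1, Yv m 0, Zv m 0, Yv m 1 + Zv m 1} ⊔ FId m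
  | _ => Ideal.span {Xv m 0, Xv m 1, Yv m 0, Zv m 0, Zv m 1} ⊔ FId m

/-- The contraction to `R_m` of the extension of `J` to the localization of `R_m`
away from `g`. -/
def contrAway (m : ℕ) (g : R m) (J : Ideal (R m)) : Ideal (R m) :=
  (J.map (algebraMap (R m) (Localization.Away g))).comap
    (algebraMap (R m) (Localization.Away g))

/-- `I_m^0` and, for `i = 1,2,3`, the ideal `I_m^i`: the contraction to `R_m` of the
extension of `J_m^i` to the localization of `R_m` away from `y_1`. -/
def Idl (m i : ℕ) : Ideal (R m) :=
  if i = 0 then I0 m else contrAway m (Yv m 1) (Jd m i)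

/-- The `ℂ`-algebra automorphism `φ₁ : x_i ↦ x_i, y_i ↦ −y_i, z_i ↦ z_i`. -/
def phi1 (m : ℕ) : R m →ₐ[ℂ] R m :=
  aeval fun v => if v.1 = 1 then -X v else X v

/-- The `ℂ`-algebra automorphism
`φ₂ : x_i ↦ x_i, y_i ↦ −(1/2)y_i + (3/2)z_i, z_i ↦ −(1/2)y_i − (1/2)z_i`. -/
def phi2 (m : ℕ) : R m →ₐ[ℂ] R m :=
  aeval fun v =>
    if v.1 = 0 then X v
    else if v.1 = 1 then C (-(1/2) : ℂ) * X (1, v.2) + C ((3/2) : ℂ) * X (2, v.2)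
    else C (-(1/2) : ℂ) * X (1, v.2) + C (-(1/2) : ℂ) * X (2, v.2)

lemma mem_contrAway {m : ℕ} {g r : R m} {J : Ideal (R m)} :
    r ∈ contrAway m g J ↔ ∃ n : ℕ, g ^ n * r ∈ J := by
  rw [contrAway, Ideal.mem_comap,
    IsLocalization.algebraMap_mem_map_algebraMap_iff (Submonoid.powers g)]
  constructor
  · rintro ⟨_, ⟨n, rfl⟩, h⟩
    exact ⟨n, h⟩
  · rintro ⟨n, h⟩
    exact ⟨_, ⟨n, rfl⟩, h⟩

/-- A ring endomorphism mapping `J` into `J'`, and `g` to a unit multiple of `g` modulo `J'`,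
maps the contraction attached to `J` into the one attached to `J'`. -/
lemma map_contrAway_le {m : ℕ} (f : R m →+* R m) {g c : R m} {J J' : Ideal (R m)}
    (hJ : J.map f ≤ J') (hc : IsUnit c) (hg : f g - c * g ∈ J') :
    (contrAway m g J).map f ≤ contrAway m g J' := by
  rw [Ideal.map_le_iff_le_comap]
  intro r hr
  obtain ⟨n, hn⟩ := mem_contrAway.1 hr
  refine mem_contrAway.2 ⟨n, ?_⟩
  have h1 : f g ^ n * f r ∈ J' := by
    simpa using hJ (Ideal.mem_map_of_mem f hn)
  have h2 : (f g ^ n - (c * g) ^ n) * f r ∈ J' :=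
    J'.mul_mem_right _ (J'.mem_of_dvd (sub_dvd_pow_sub_pow _ _ n) hg)
  have h3 : c ^ n * (g ^ n * f r) ∈ J' := by
    convert J'.sub_mem h1 h2 using 1
    ring
  exact (J'.unit_mul_mem_iff_mem (hc.pow n)).1 h3

section Variables

variable (m i : ℕ)

lemma phi1_Xv : phi1 m (Xv m i) = Xv m i := by
  unfold Xv; split_ifs <;> simp [phi1]

lemma phi1_Yv : phi1 m (Yv m i) = -Yv m i := by
  unfold Yv; split_ifs <;> simp [phi1]

lemma phi1_Zv : phi1 m (Zv m i) = Zv m i := by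
  unfold Zv; split_ifs <;> simp [phi1]

lemma phi2_Xv : phi2 m (Xv m i) = Xv m i := by
  unfold Xv; split_ifs <;> simp [phi2]

lemma phi2_Yv :
    phi2 m (Yv m i) = C (-(1/2) : ℂ) * Yv m i + C ((3/2) : ℂ) * Zv m i := by
  unfold Yv Zv; split_ifs <;> simp [phi2]

lemma phi2_Zv :
    phi2 m (Zv m i) = C (-(1/2) : ℂ) * Yv m i + C (-(1/2) : ℂ) * Zv m i := by
  unfold Yv Zv; split_ifs <;> simp [phi2]

end Variables

lemma fD_map {m : ℕ} (f : R m →+* R m)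
    (h : (xSer m).map f ^ 2 - (ySer m).map f ^ 2 * (zSer m).map f + (zSer m).map f ^ 3 =
      xSer m ^ 2 - ySer m ^ 2 * zSer m + zSer m ^ 3) (j : ℕ) : f (fD m j) = fD m j := by
  rw [fD, ← Polynomial.coeff_map]
  simp only [Polynomial.map_add, Polynomial.map_sub, Polynomial.map_mul, Polynomial.map_pow, h]

lemma C_three_halves (m : ℕ) : (C (3/2 : ℂ) : R m) = -3 * C (-(1/2) : ℂ) := by
  rw [show (3/2 : ℂ) = -3 * -(1/2) by norm_num, C_mul, map_neg, map_ofNat]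

lemma two_mul_C_neg_half (m : ℕ) : 2 * (C (-(1/2) : ℂ) : R m) = -1 := by
  rw [show (2 : R m) = C (2 : ℂ) from (map_ofNat C 2).symm, ← C_mul]
  norm_num

lemma isUnit_C_neg_half (m : ℕ) : IsUnit (C (-(1/2) : ℂ) : R m) :=
  (IsUnit.mk0 _ (by norm_num)).map C

lemma phi1_fD (m j : ℕ) : (phi1 m).toRingHom (fD m j) = fD m j := by
  apply fD_map
  have hx : (xSer m).map (phi1 m).toRingHom = xSer m := by
    simp [xSer, Polynomial.map_sum, phi1_Xv]
  have hy : (ySer m).map (phi1 m).toRingHom = -ySer m := by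
    simp only [ySer, Polynomial.map_sum, ← Finset.sum_neg_distrib]
    refine Finset.sum_congr rfl fun i _ => ?_
    simp only [Polynomial.map_mul, Polynomial.map_C, Polynomial.map_pow, Polynomial.map_X,
      AlgHom.toRingHom_eq_coe, RingHom.coe_coe, phi1_Yv, Polynomial.C_neg]
    ring
  have hz : (zSer m).map (phi1 m).toRingHom = zSer m := by
    simp [zSer, Polynomial.map_sum, phi1_Zv]
  rw [hx, hy, hz]
  ring

lemma phi2_fD (m j : ℕ) : (phi2 m).toRingHom (fD m j) = fD m j := by
  apply fD_map
  have hx : (xSer m).map (phi2 m).toRingHom = xSer m := by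
    simp [xSer, Polynomial.map_sum, phi2_Xv]
  have hy : (ySer m).map (phi2 m).toRingHom =
      Polynomial.C (C (-(1/2) : ℂ)) * ySer m + Polynomial.C (C (3/2 : ℂ)) * zSer m := by
    simp only [ySer, zSer, Polynomial.map_sum, Finset.mul_sum, ← Finset.sum_add_distrib]
    refine Finset.sum_congr rfl fun i _ => ?_
    simp only [Polynomial.map_mul, Polynomial.map_C, Polynomial.map_pow, Polynomial.map_X,
      AlgHom.toRingHom_eq_coe, RingHom.coe_coe, phi2_Yv, Polynomial.C_add, Polynomial.C_mul]
    ring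
  have hz : (zSer m).map (phi2 m).toRingHom =
      Polynomial.C (C (-(1/2) : ℂ)) * ySer m + Polynomial.C (C (-(1/2) : ℂ)) * zSer m := by
    simp only [ySer, zSer, Polynomial.map_sum, Finset.mul_sum, ← Finset.sum_add_distrib]
    refine Finset.sum_congr rfl fun i _ => ?_
    simp only [Polynomial.map_mul, Polynomial.map_C, Polynomial.map_pow, Polynomial.map_X,
      AlgHom.toRingHom_eq_coe, RingHom.coe_coe, phi2_Zv, Polynomial.C_add, Polynomial.C_mul]
    ring
  rw [hx, hy, hz]
  have h1 : 2 * Polynomial.C (C (-(1/2) : ℂ) : R m) = -1 := by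
    simpa only [Polynomial.C_mul, Polynomial.C_neg, Polynomial.C_1, Polynomial.C_ofNat] using
      congrArg Polynomial.C (two_mul_C_neg_half m)
  simp only [C_three_halves, Polynomial.C_mul, Polynomial.C_neg, Polynomial.C_ofNat]
  generalize Polynomial.C (C (-(1/2) : ℂ) : R m) = a at h1 ⊢
  linear_combination
    (zSer m ^ 3 - ySer m ^ 2 * zSer m) * (-(4 * a ^ 2 - 2 * a + 1)) * h1

lemma phi1_phi1 (m : ℕ) : (phi1 m).toRingHom.comp (phi1 m).toRingHom = RingHom.id _ := by
  have : (phi1 m).comp (phi1 m) = AlgHom.id ℂ _ := by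
    ext ⟨k, i⟩ : 1
    fin_cases k <;> simp [phi1]
  exact congrArg AlgHom.toRingHom this

lemma phi2_phi2_phi2 (m : ℕ) :
    (phi2 m).toRingHom.comp ((phi2 m).toRingHom.comp (phi2 m).toRingHom) = RingHom.id _ := by
  have : (phi2 m).comp ((phi2 m).comp (phi2 m)) = AlgHom.id ℂ _ := by
    have h := two_mul_C_neg_half m
    have hX (i) : phi2 m (X (0, i)) = X (0, i) := by simp [phi2]
    have hY (i) : phi2 m (X (1, i)) =
        C (-(1/2) : ℂ) * X (1, i) + -3 * C (-(1/2) : ℂ) * X (2, i) := by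
      rw [← C_three_halves]; simp [phi2]
    have hZ (i) : phi2 m (X (2, i)) =
        C (-(1/2) : ℂ) * X (1, i) + C (-(1/2) : ℂ) * X (2, i) := by
      simp [phi2]
    have hC : phi2 m (C (-(1/2) : ℂ)) = C (-(1/2) : ℂ) := algHom_C _ _
    refine algHom_ext fun ⟨k, i⟩ => ?_
    generalize C (-(1/2) : ℂ) = a at h hY hZ hC
    fin_cases k
    · simp [hX]
    · simp only [Fin.mk_one, AlgHom.comp_apply, AlgHom.id_apply, hY, hZ, map_add, map_mul, map_neg,
        map_ofNat, hC]
      linear_combination (-(4 * a ^ 2 - 2 * a + 1)) * X (1, i) * h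
    · simp only [Fin.reduceFinMk, AlgHom.comp_apply, AlgHom.id_apply, hY, hZ, map_add, map_mul,
        map_neg, map_ofNat, hC]
      linear_combination (-(4 * a ^ 2 - 2 * a + 1)) * X (2, i) * h
  exact congrArg AlgHom.toRingHom this

lemma map_span_sup_FId_le {m : ℕ} {f : R m →+* R m} (hf : ∀ j, f (fD m j) = fD m j)
    {s : Set (R m)} {K : Ideal (R m)} (hs : ∀ a ∈ s, f a ∈ K) :
    (Ideal.span s ⊔ FId m).map f ≤ K ⊔ FId m := by
  rw [Ideal.map_sup]
  refine sup_le_sup ?_ ?_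
  · rw [Ideal.map_span, Ideal.span_le]
    rintro _ ⟨a, ha, rfl⟩
    exact hs a ha
  · rw [FId, Ideal.map_span]
    refine Ideal.span_mono ?_
    rintro _ ⟨_, ⟨j, hj, rfl⟩, rfl⟩
    exact ⟨j, hj, hf j⟩

lemma map_eq_of_comp_eq_id {A : Type*} [CommRing A] {f g : A →+* A} (h : f.comp g = RingHom.id A)
    {I J : Ideal A} (hf : I.map f ≤ J) (hg : J.map g ≤ I) : I.map f = J := by
  refine le_antisymm hf ?_
  calc J = (J.map g).map f := by rw [Ideal.map_map, h, Ideal.map_id]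
    _ ≤ I.map f := Ideal.map_mono hg

/-- A combination of two elements of an ideal, in the shape produced by `phi2`. -/
lemma mul_add_mul_mem {A : Type*} [CommRing A] {K : Ideal A} {a b : A} (c d : A) (ha : a ∈ K)
    (hb : b ∈ K) : c * a + d * b ∈ K :=
  K.add_mem (K.mul_mem_left _ ha) (K.mul_mem_left _ hb)

lemma map_phi1_I0_le (m : ℕ) : (I0 m).map (phi1 m).toRingHom ≤ I0 m := by
  refine map_span_sup_FId_le (phi1_fD m) ?_
  rintro a (rfl | rfl | rfl | rfl | rfl | rfl | rfl) <;>
  simp only [AlgHom.toRingHom_eq_coe, RingHom.coe_coe, phi1_Xv, phi1_Yv, phi1_Zv, neg_mem_iff] <;>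
  exact Ideal.subset_span (by simp)

lemma map_phi2_I0_le (m : ℕ) : (I0 m).map (phi2 m).toRingHom ≤ I0 m := by
  refine map_span_sup_FId_le (phi2_fD m) ?_
  rintro a (rfl | rfl | rfl | rfl | rfl | rfl | rfl) <;>
  simp only [AlgHom.toRingHom_eq_coe, RingHom.coe_coe, phi2_Xv, phi2_Yv, phi2_Zv] <;>
  first
  | exact mul_add_mul_mem _ _ (Ideal.subset_span (by simp)) (Ideal.subset_span (by simp))
  | exact Ideal.subset_span (by simp)

/-- To map one of the ideals `I_m^i`, `i ≥ 1`, into another, it suffices to check the images of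
the distinguished linear form `a` and of `y_1`. -/
lemma map_contrAway_span_le {m : ℕ} {f : R m →+* R m} (hf : ∀ j, f (fD m j) = fD m j) {a b c : R m}
    (hX : ∀ i, f (Xv m i) = Xv m i)
    (hY : f (Yv m 0) ∈ Ideal.span {Yv m 0, Zv m 0})
    (hZ : f (Zv m 0) ∈ Ideal.span {Yv m 0, Zv m 0})
    (ha : b ∣ f a) (hc : IsUnit c) (hg : b ∣ f (Yv m 1) - c * Yv m 1) :
    (contrAway m (Yv m 1) (Ideal.span {Xv m 0, Xv m 1, Yv m 0, Zv m 0, a} ⊔ FId m)).map f ≤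
      contrAway m (Yv m 1) (Ideal.span {Xv m 0, Xv m 1, Yv m 0, Zv m 0, b} ⊔ FId m) := by
  have hb : b ∈ Ideal.span {Xv m 0, Xv m 1, Yv m 0, Zv m 0, b} := Ideal.subset_span (by simp)
  have hle : Ideal.span {Yv m 0, Zv m 0} ≤ Ideal.span {Xv m 0, Xv m 1, Yv m 0, Zv m 0, b} :=
    Ideal.span_mono (by intro; simp; tauto)
  refine map_contrAway_le f (map_span_sup_FId_le hf ?_) hc
    (Ideal.mem_sup_left (Ideal.mem_of_dvd _ hg hb))
  rintro _ (rfl | rfl | rfl | rfl | rfl)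
  · rw [hX]; exact Ideal.subset_span (by simp)
  · rw [hX]; exact Ideal.subset_span (by simp)
  · exact hle hY
  · exact hle hZ
  · exact Ideal.mem_of_dvd _ ha hb

lemma map_contrAway_span_phi1_le (m : ℕ) {a b c : R m} (ha : b ∣ phi1 m a) (hc : IsUnit c)
    (hg : b ∣ phi1 m (Yv m 1) - c * Yv m 1) :
    (contrAway m (Yv m 1) (Ideal.span {Xv m 0, Xv m 1, Yv m 0, Zv m 0, a} ⊔ FId m)).map
        (phi1 m).toRingHom ≤
      contrAway m (Yv m 1) (Ideal.span {Xv m 0, Xv m 1, Yv m 0, Zv m 0, b} ⊔ FId m) := by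
  refine map_contrAway_span_le (phi1_fD m) (phi1_Xv m) ?_ ?_ ha hc hg
  · exact (phi1_Yv m 0).symm ▸ neg_mem (Ideal.subset_span (by simp))
  · exact (phi1_Zv m 0).symm ▸ Ideal.subset_span (by simp)

lemma map_contrAway_span_phi2_le (m : ℕ) {a b c : R m} (ha : b ∣ phi2 m a) (hc : IsUnit c)
    (hg : b ∣ phi2 m (Yv m 1) - c * Yv m 1) :
    (contrAway m (Yv m 1) (Ideal.span {Xv m 0, Xv m 1, Yv m 0, Zv m 0, a} ⊔ FId m)).map
        (phi2 m).toRingHom ≤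
      contrAway m (Yv m 1) (Ideal.span {Xv m 0, Xv m 1, Yv m 0, Zv m 0, b} ⊔ FId m) := by
  refine map_contrAway_span_le (phi2_fD m) (phi2_Xv m) ?_ ?_ ha hc hg
  · exact (phi2_Yv m 0).symm ▸
      mul_add_mul_mem _ _ (Ideal.subset_span (by simp)) (Ideal.subset_span (by simp))
  · exact (phi2_Zv m 0).symm ▸
      mul_add_mul_mem _ _ (Ideal.subset_span (by simp)) (Ideal.subset_span (by simp))

lemma map_phi1_Idl_one_le (m : ℕ) :
    (Idl m 1).map (phi1 m).toRingHom ≤ Idl m 1 := by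
  refine map_contrAway_span_phi1_le m (c := -1) ?_ isUnit_one.neg ?_
  · refine ⟨1, ?_⟩
    simp only [phi1_Zv]
    ring
  · refine ⟨0, ?_⟩
    simp only [phi1_Yv]
    ring

lemma map_phi1_Idl_two_le (m : ℕ) :
    (Idl m 2).map (phi1 m).toRingHom ≤ Idl m 3 := by
  refine map_contrAway_span_phi1_le m (c := -1) ?_ isUnit_one.neg ?_
  · refine ⟨-1, ?_⟩
    simp only [map_sub, phi1_Yv, phi1_Zv]
    ring
  · refine ⟨0, ?_⟩
    simp only [phi1_Yv]
    ring

lemma map_phi1_Idl_three_le (m : ℕ) :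
    (Idl m 3).map (phi1 m).toRingHom ≤ Idl m 2 := by
  refine map_contrAway_span_phi1_le m (c := -1) ?_ isUnit_one.neg ?_
  · refine ⟨-1, ?_⟩
    simp only [map_add, phi1_Yv, phi1_Zv]
    ring
  · refine ⟨0, ?_⟩
    simp only [phi1_Yv]
    ring

lemma map_phi2_Idl_one_le (m : ℕ) :
    (Idl m 1).map (phi2 m).toRingHom ≤ Idl m 3 := by
  have h := two_mul_C_neg_half m
  refine map_contrAway_span_phi2_le m (c := C (-2 : ℂ)) ?_ ((IsUnit.mk0 _ (by norm_num)).map C) ?_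
  · refine ⟨C (-(1/2) : ℂ), ?_⟩
    simp only [phi2_Zv]
    ring
  · refine ⟨-3 * C (-(1/2) : ℂ), ?_⟩
    have hc : (C (-2 : ℂ) : R m) = -2 := by rw [map_neg, map_ofNat]
    simp only [phi2_Yv, C_three_halves, hc]
    linear_combination 2 * Yv m 1 * h

lemma map_phi2_Idl_two_le (m : ℕ) :
    (Idl m 2).map (phi2 m).toRingHom ≤ Idl m 1 := by
  refine map_contrAway_span_phi2_le m (c := C (-(1/2) : ℂ)) ?_ (isUnit_C_neg_half m) ?_
  · refine ⟨-4 * C (-(1/2) : ℂ), ?_⟩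
    simp only [map_sub, phi2_Yv, phi2_Zv, C_three_halves]
    ring
  · refine ⟨-3 * C (-(1/2) : ℂ), ?_⟩
    simp only [phi2_Yv, C_three_halves]
    ring

lemma map_phi2_Idl_three_le (m : ℕ) :
    (Idl m 3).map (phi2 m).toRingHom ≤ Idl m 2 := by
  have h := two_mul_C_neg_half m
  refine map_contrAway_span_phi2_le m (c := 1) ?_ isUnit_one ?_
  · refine ⟨2 * C (-(1/2) : ℂ), ?_⟩
    simp only [map_add, phi2_Yv, phi2_Zv, C_three_halves]
    ring
  · refine ⟨3 * C (-(1/2) : ℂ), ?_⟩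
    simp only [phi2_Yv, C_three_halves]
    linear_combination -Yv m 1 * h

/- STATEMENT 14: for `m ≥ 5`:
`φ₁(I_m^0) = I_m^0`, `φ₁(I_m^1) = I_m^1`, `φ₁(I_m^2) = I_m^3`, `φ₁(I_m^3) = I_m^2`,
`φ₂(I_m^0) = I_m^0`, `φ₂(I_m^1) = I_m^3`, `φ₂(I_m^2) = I_m^1`, `φ₂(I_m^3) = I_m^2`. -/
theorem stmt14 (m : ℕ) (hm : 5 ≤ m) :
    (Idl m 0).map (phi1 m).toRingHom = Idl m 0 ∧
    (Idl m 1).map (phi1 m).toRingHom = Idl m 1 ∧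
    (Idl m 2).map (phi1 m).toRingHom = Idl m 3 ∧
    (Idl m 3).map (phi1 m).toRingHom = Idl m 2 ∧
    (Idl m 0).map (phi2 m).toRingHom = Idl m 0 ∧
    (Idl m 1).map (phi2 m).toRingHom = Idl m 3 ∧
    (Idl m 2).map (phi2 m).toRingHom = Idl m 1 ∧
    (Idl m 3).map (phi2 m).toRingHom = Idl m 2 := by
  have h0 : Idl m 0 = I0 m := if_pos rfl
  simp only [h0]
  refine ⟨map_eq_of_comp_eq_id (phi1_phi1 m) (map_phi1_I0_le m) (map_phi1_I0_le m),
    map_eq_of_comp_eq_id (phi1_phi1 m) (map_phi1_Idl_one_le m) (map_phi1_Idl_one_le m),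
    map_eq_of_comp_eq_id (phi1_phi1 m) (map_phi1_Idl_two_le m) (map_phi1_Idl_three_le m),
    map_eq_of_comp_eq_id (phi1_phi1 m) (map_phi1_Idl_three_le m) (map_phi1_Idl_two_le m),
    map_eq_of_comp_eq_id (phi2_phi2_phi2 m) (map_phi2_I0_le m) ?_,
    map_eq_of_comp_eq_id (phi2_phi2_phi2 m) (map_phi2_Idl_one_le m) ?_,
    map_eq_of_comp_eq_id (phi2_phi2_phi2 m) (map_phi2_Idl_two_le m) ?_,
    map_eq_of_comp_eq_id (phi2_phi2_phi2 m) (map_phi2_Idl_three_le m) ?_⟩ <;>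
  rw [← Ideal.map_map]
  · exact (Ideal.map_mono (map_phi2_I0_le m)).trans (map_phi2_I0_le m)
  · exact (Ideal.map_mono (map_phi2_Idl_three_le m)).trans (map_phi2_Idl_two_le m)
  · exact (Ideal.map_mono (map_phi2_Idl_one_le m)).trans (map_phi2_Idl_three_le m)
  · exact (Ideal.map_mono (map_phi2_Idl_two_le m)).trans (map_phi2_Idl_one_le m)

end
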